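/- Let n ≥ 2, let H ≤ S_n be semiregular with orbit transversal R, and let G ≤ N_{S_n}(H) ∩ Stab_{S_n}(R). Then the transducer map A_id is a homeomorphism of 𝔠_n, and the map φ defined by (v)φ = A_id^{-1} ∘ v ∘ A_id (conjugation inside the homeomorphism group of 𝔠_n) is a group isomorphism from V_n(HG) onto V_n(G). -/

import Mathlib

open scoped Classical Pointwise

/-- The group of self-homeomorphisms of a topological space, with
`(f * g) x = f (g x)`. -/
instance homeoGroup (X : Type*) [TopologicalSpace X] : Group (X ≃ₜ X) where
  mul a b := b.trans a
  one := Homeomorph.refl X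
  inv := Homeomorph.symm
  mul_assoc a b c := Homeomorph.ext fun _ => rfl
  one_mul a := Homeomorph.ext fun _ => rfl
  mul_one a := Homeomorph.ext fun _ => rfl
  inv_mul_cancel a := Homeomorph.ext fun x => a.symm_apply_apply x

/-- The `n`-ary Cantor space: infinite sequences over an `n`-letter alphabet. -/
abbrev Cantor (n : ℕ) := ℕ → Fin n

/-- Prefix a sequence by a finite word. -/
def appendWord {n : ℕ} (θ : List (Fin n)) (x : Cantor n) : Cantor n :=
  fun i => if h : i < θ.length then θ.get ⟨i, h⟩ else x (i - θ.length)

/-- `x` lies in the cone `[θ]`, i.e. has `θ` as a prefix. -/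
def inCone {n : ℕ} (θ : List (Fin n)) (x : Cantor n) : Prop :=
  ∀ i, (h : i < θ.length) → x i = θ.get ⟨i, h⟩

/-- A map is a prefix-substitution map if it is given by two partitions of the
Cantor space into cones `[α i]` resp. `[β i]`, replacing the prefix `α i` by `β i`. -/
def IsPrefixMap {n : ℕ} (v : Cantor n → Cantor n) : Prop :=
  ∃ (t : ℕ) (α β : Fin t → List (Fin n)),
    (∀ x : Cantor n, ∃! i, inCone (α i) x) ∧
    (∀ x : Cantor n, ∃! i, inCone (β i) x) ∧
    ∀ (i : Fin t) (γ : Cantor n), v (appendWord (α i) γ) = appendWord (β i) γ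

/-- The Higman–Thompson group `V_n`, as a subgroup of the homeomorphism group of
the `n`-ary Cantor space: the group of all prefix-substitution homeomorphisms. -/
def HigmanThompson (n : ℕ) : Subgroup (Cantor n ≃ₜ Cantor n) :=
  Subgroup.closure {v | IsPrefixMap ⇑v}

/-- The iterated permutation `[α]_g` (as a function): identity outside the cone
`[α]`, and applying `g` to every letter after the prefix `α` inside it.
With `α = []` this is `[∅]_g`, applying `g` to every letter. -/
noncomputable def iterPermFun {n : ℕ} (α : List (Fin n)) (g : Equiv.Perm (Fin n))
    (x : Cantor n) : Cantor n :=
  if inCone α x then fun i => if i < α.length then x i else g (x i) else x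

/-- The group `V_n(G)`: the subgroup of the homeomorphism group of the `n`-ary
Cantor space generated by `V_n` together with all iterated permutations `[α]_g`
for `g ∈ G` and finite words `α`. -/
def VnG (n : ℕ) (G : Subgroup (Equiv.Perm (Fin n))) : Subgroup (Cantor n ≃ₜ Cantor n) :=
  Subgroup.closure
    ({v | IsPrefixMap ⇑v} ∪
      {v | ∃ (α : List (Fin n)) (g : Equiv.Perm (Fin n)), g ∈ G ∧ ⇑v = iterPermFun α g})

/-- A permutation group is semiregular if no nontrivial element has a fixed point. -/
def Semiregular {n : ℕ} (G : Subgroup (Equiv.Perm (Fin n))) : Prop :=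
  ∀ g ∈ G, (∃ x, g x = x) → g = 1

/-- `R` is an orbit transversal for the natural action of `H ≤ S_n` on the `n`
points: it contains exactly one point of each `H`-orbit. -/
def IsTransversal {n : ℕ} (H : Subgroup (Equiv.Perm (Fin n))) (R : Set (Fin n)) : Prop :=
  ∀ x : Fin n, ∃! r, r ∈ R ∧ ∃ h ∈ H, h x = r

/-- `hmap` assigns to each letter `i` the (unique) element `h_i` of `H` with
`i ⬝ h_i ∈ R`. -/
def IsHmap {n : ℕ} (H : Subgroup (Equiv.Perm (Fin n))) (R : Set (Fin n))
    (hmap : Fin n → Equiv.Perm (Fin n)) : Prop :=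
  ∀ i : Fin n, hmap i ∈ H ∧ hmap i i ∈ R

/-- The transducer map `A_h` on the Cantor space: the first letter is moved by
`h`, and each subsequent letter `x_{k+1}` is moved by `h_{x_k}` (here `hmap i`
plays the role of `h_i`). -/
def AFun {n : ℕ} (h : Equiv.Perm (Fin n)) (hmap : Fin n → Equiv.Perm (Fin n))
    (x : Cantor n) : Cantor n
  | 0 => h (x 0)
  | k + 1 => hmap (x k) (x (k + 1))

namespace TransducerProof

lemma homeo_mul_apply {n : ℕ} (a b : Cantor n ≃ₜ Cantor n) (x : Cantor n) :
    (a * b) x = a (b x) := rfl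

lemma homeo_one_apply {n : ℕ} (x : Cantor n) :
    (1 : Cantor n ≃ₜ Cantor n) x = x := rfl

lemma homeo_inv_apply_self {n : ℕ} (a : Cantor n ≃ₜ Cantor n) (x : Cantor n) :
    a⁻¹ (a x) = x := a.symm_apply_apply x

lemma homeo_apply_inv_self {n : ℕ} (a : Cantor n ≃ₜ Cantor n) (x : Cantor n) :
    a (a⁻¹ x) = x := a.apply_symm_apply x

/-- Agreement of two sequences on the first `N` letters. -/
def Agr {n : ℕ} (N : ℕ) (x y : Cantor n) : Prop := ∀ i, i < N → x i = y i

lemma agr_isOpen {n : ℕ} (N : ℕ) (x : Cantor n) : IsOpen {y : Cantor n | Agr N y x} := by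
  have : {y : Cantor n | Agr N y x} = ⋂ i ∈ Finset.range N, {y : Cantor n | y i = x i} := by
    ext y; simp [Agr]
  rw [this]
  refine isOpen_biInter_finset fun i _ => ?_
  exact (isOpen_discrete ({x i} : Set (Fin n))).preimage (continuous_apply (A := fun _ : ℕ => Fin n) i)

lemma continuous_of_agr {n : ℕ} (f : Cantor n → Cantor n)
    (hf : ∀ i, ∃ N, ∀ x y, Agr N x y → f x i = f y i) : Continuous f := by
  refine continuous_pi fun i => ?_
  refine IsLocallyConstant.continuous ?_
  rw [IsLocallyConstant.iff_exists_open]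
  intro x
  obtain ⟨N, hN⟩ := hf i
  exact ⟨_, agr_isOpen N x, fun _ _ => rfl, fun y hy => hN y x hy⟩

/-- Near `x`, `v` replaces a prefix and acts by `g ∈ K` letterwise on the tail. -/
def LocAt {n : ℕ} (K : Subgroup (Equiv.Perm (Fin n))) (v : Cantor n → Cantor n)
    (x : Cantor n) (m l : ℕ) (g : Equiv.Perm (Fin n)) : Prop :=
  g ∈ K ∧ ∀ x', Agr m x' x → Agr l (v x') (v x) ∧ ∀ i, v x' (l + i) = g (x' (m + i))

def Loc {n : ℕ} (K : Subgroup (Equiv.Perm (Fin n))) (v : Cantor n → Cantor n) : Prop :=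
  ∀ x, ∃ m l g, LocAt K v x m l g

lemma LocAt.extend {n : ℕ} {K : Subgroup (Equiv.Perm (Fin n))} {v : Cantor n → Cantor n}
    {x : Cantor n} {m l : ℕ} {g : Equiv.Perm (Fin n)} (h : LocAt K v x m l g) (k : ℕ) :
    LocAt K v x (m + k) (l + k) g := by
  refine ⟨h.1, fun x' hx' => ?_⟩
  have h1 := h.2 x' (fun i hi => hx' i (by omega))
  have h0 := h.2 x (fun i hi => rfl)
  refine ⟨fun i hi => ?_, fun i => ?_⟩
  · by_cases hil : i < l
    · exact h1.1 i hil
    · obtain ⟨j, rfl⟩ := Nat.exists_eq_add_of_le (not_lt.mp hil)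
      rw [h1.2, h0.2, hx' _ (by omega)]
  · rw [add_assoc, add_assoc, h1.2]

lemma Loc.mul {n : ℕ} {K : Subgroup (Equiv.Perm (Fin n))} {u v : Cantor n ≃ₜ Cantor n}
    (hu : Loc K u) (hv : Loc K v) : Loc K ⇑(u * v) := by
  intro x
  obtain ⟨m, l, g, h⟩ := hv x
  obtain ⟨m', l', g', h'⟩ := hu (v x)
  have h1 := h.extend m'
  have h2 := h'.extend l
  rw [add_comm m' l] at h2
  refine ⟨m + m', l' + l, g' * g, K.mul_mem h2.1 h1.1, fun x' hx' => ?_⟩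
  obtain ⟨a, b⟩ := h1.2 x' hx'
  obtain ⟨c, d⟩ := h2.2 (v x') a
  refine ⟨c, fun i => ?_⟩
  rw [homeo_mul_apply, d, b]; rfl

lemma Loc.one {n : ℕ} {K : Subgroup (Equiv.Perm (Fin n))} :
    Loc K ⇑(1 : Cantor n ≃ₜ Cantor n) := by
  intro x
  exact ⟨0, 0, 1, K.one_mem, fun x' _ => ⟨fun i hi => absurd hi (by omega), fun i => rfl⟩⟩

/-- Glue the first `m` letters of `x` with the tail `t`. -/
def glue {n : ℕ} (m : ℕ) (x t : Cantor n) : Cantor n := fun i => if i < m then x i else t (i - m)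

lemma glue_agr {n : ℕ} (m : ℕ) (x t : Cantor n) : Agr m (glue m x t) x := by
  intro i hi; simp [glue, hi]

lemma glue_add {n : ℕ} (m : ℕ) (x t : Cantor n) (i : ℕ) : glue m x t (m + i) = t i := by
  simp [glue]

lemma ext_split {n : ℕ} {x y : Cantor n} (l : ℕ) (h : Agr l x y)
    (h2 : ∀ i, x (l + i) = y (l + i)) : x = y := by
  funext i
  by_cases hil : i < l
  · exact h i hil
  · obtain ⟨j, rfl⟩ := Nat.exists_eq_add_of_le (not_lt.mp hil)
    exact h2 j

lemma Loc.inv {n : ℕ} {K : Subgroup (Equiv.Perm (Fin n))} {v : Cantor n ≃ₜ Cantor n}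
    (hv : Loc K v) : Loc K ⇑(v⁻¹) := by
  intro y
  obtain ⟨m, l, g, h⟩ := hv (v⁻¹ y)
  refine ⟨l, m, g⁻¹, K.inv_mem h.1, fun y' hy' => ?_⟩
  set x := v⁻¹ y with hx
  have hvx : v x = y := homeo_apply_inv_self v y
  set z := glue m x (fun i => g⁻¹ (y' (l + i))) with hz
  obtain ⟨a, b⟩ := h.2 z (glue_agr _ _ _)
  have hvz : v z = y' := by
    refine ext_split l (fun i hi => ?_) (fun i => ?_)
    · rw [a i hi, hvx, hy' i hi]
    · rw [b i, hz, glue_add]; simp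
  have : v⁻¹ y' = z := by rw [← hvz]; exact homeo_inv_apply_self v z
  rw [this]
  exact ⟨glue_agr _ _ _, fun i => by rw [hz, glue_add]⟩

lemma inCone_appendWord {n : ℕ} (θ : List (Fin n)) (x : Cantor n) : inCone θ (appendWord θ x) := by
  intro i h; simp [appendWord, h]

lemma appendWord_add {n : ℕ} (θ : List (Fin n)) (x : Cantor n) (i : ℕ) :
    appendWord θ x (θ.length + i) = x i := by
  simp [appendWord]

lemma eq_appendWord {n : ℕ} (θ : List (Fin n)) (x : Cantor n) (h : inCone θ x) :
    x = appendWord θ (fun i => x (θ.length + i)) := by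
  refine ext_split θ.length (fun i hi => ?_) (fun i => ?_)
  · rw [h i hi]; simp [appendWord, hi]
  · rw [appendWord_add]

lemma _root_.inCone.agr {n : ℕ} {θ : List (Fin n)} {x y : Cantor n} (h : inCone θ x)
    (h' : Agr θ.length y x) : inCone θ y := by
  intro i hi; rw [h' i hi, h i hi]

lemma _root_.inCone.agr2 {n : ℕ} {θ : List (Fin n)} {x y : Cantor n} (h : inCone θ x)
    (h' : inCone θ y) : Agr θ.length x y := by
  intro i hi; rw [h' i hi, h i hi]

lemma loc_of_prefixMap {n : ℕ} (K : Subgroup (Equiv.Perm (Fin n))) {v : Cantor n → Cantor n}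
    (hv : IsPrefixMap v) : Loc K v := by
  obtain ⟨t, α, β, hα, hβ, h⟩ := hv
  intro x
  obtain ⟨i, hi, -⟩ := hα x
  refine ⟨(α i).length, (β i).length, 1, K.one_mem, fun x' hx' => ?_⟩
  have hi' : inCone (α i) x' := hi.agr hx'
  have e := congrArg v (eq_appendWord _ _ hi)
  have e' := congrArg v (eq_appendWord _ _ hi')
  rw [h] at e e'
  rw [e, e']
  exact ⟨(inCone_appendWord _ _).agr2 (inCone_appendWord _ _), fun j => by rw [appendWord_add]; rfl⟩

lemma loc_of_iterPerm {n : ℕ} (K : Subgroup (Equiv.Perm (Fin n))) (α : List (Fin n))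
    (g : Equiv.Perm (Fin n)) (hg : g ∈ K) : Loc K (iterPermFun α g) := by
  intro x
  by_cases hx : inCone α x
  · refine ⟨α.length, α.length, g, hg, fun x' hx' => ?_⟩
    have hx2 : inCone α x' := hx.agr hx'
    simp only [iterPermFun, hx, hx2, if_true]
    refine ⟨fun i hi => by simp [hi, hx' i hi], fun i => by simp⟩
  · refine ⟨α.length, α.length, 1, K.one_mem, fun x' hx' => ?_⟩
    have hx2 : ¬ inCone α x' := fun h => hx (h.agr fun i hi => (hx' i hi).symm)
    simp only [iterPermFun, hx, hx2, if_false]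
    exact ⟨hx', fun i => rfl⟩

lemma loc_of_mem {n : ℕ} (K : Subgroup (Equiv.Perm (Fin n))) (v : Cantor n ≃ₜ Cantor n)
    (hv : v ∈ VnG n K) : Loc K v := by
  induction hv using Subgroup.closure_induction with
  | mem v h =>
    rcases h with h | ⟨α, g, hg, h⟩
    · exact loc_of_prefixMap K h
    · rw [h]; exact loc_of_iterPerm K α g hg
  | one => exact Loc.one
  | mul u v _ _ hu hv => exact hu.mul hv
  | inv v _ hv => exact hv.inv

lemma inCone_iterPermFun {n : ℕ} (α : List (Fin n)) (g : Equiv.Perm (Fin n)) (x : Cantor n)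
    (h : inCone α x) : inCone α (iterPermFun α g x) := by
  intro i hi
  simp [iterPermFun, h, hi, h i hi]

lemma iterPermFun_comp {n : ℕ} (α : List (Fin n)) (g k : Equiv.Perm (Fin n)) (hgk : g * k = 1)
    (x : Cantor n) : iterPermFun α g (iterPermFun α k x) = x := by
  by_cases h : inCone α x
  · have h2 := inCone_iterPermFun α k x h
    rw [iterPermFun, if_pos h2]
    funext i
    simp only [iterPermFun, h, if_true]
    split_ifs
    · rfl
    · exact Equiv.Perm.ext_iff.mp hgk (x i)
  · have : iterPermFun α k x = x := by simp [iterPermFun, h]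
    rw [this]; simp [iterPermFun, h]

lemma continuous_iterPermFun {n : ℕ} (α : List (Fin n)) (g : Equiv.Perm (Fin n)) :
    Continuous (iterPermFun α g) := by
  refine continuous_of_agr _ fun i => ⟨α.length + i + 1, fun x y hxy => ?_⟩
  have h1 : Agr α.length x y := fun j hj => hxy j (by omega)
  have h2 : inCone α x ↔ inCone α y :=
    ⟨fun h => h.agr fun j hj => (h1 j hj).symm, fun h => h.agr h1⟩
  have h3 := hxy i (by omega)
  by_cases hy : inCone α y
  · simp [iterPermFun, h2.mpr hy, hy, h3]
  · have : ¬ inCone α x := fun h => hy (h2.mp h)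
    simp [iterPermFun, hy, this, h3]

noncomputable def iterPermHomeo {n : ℕ} (α : List (Fin n)) (g : Equiv.Perm (Fin n)) :
    Cantor n ≃ₜ Cantor n where
  toFun := iterPermFun α g
  invFun := iterPermFun α g⁻¹
  left_inv x := iterPermFun_comp α g⁻¹ g (by simp) x
  right_inv x := iterPermFun_comp α g g⁻¹ (by simp) x
  continuous_toFun := continuous_iterPermFun α g
  continuous_invFun := continuous_iterPermFun α g⁻¹

/-- The first `M` letters of a sequence. -/
def pre {n : ℕ} (M : ℕ) (x : Cantor n) : Fin M → Fin n := fun i => x i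

lemma pre_eq_iff {n : ℕ} (M : ℕ) (x y : Cantor n) : pre M x = pre M y ↔ Agr M x y :=
  ⟨fun h i hi => congrFun h ⟨i, hi⟩, fun h => funext fun i => h i i.2⟩

lemma inCone_ofFn {n M : ℕ} (w : Fin M → Fin n) (x : Cantor n) :
    inCone (List.ofFn w) x ↔ pre M x = w := by
  constructor
  · intro h; funext i
    have := h i (by simp)
    simpa [pre] using this
  · rintro rfl i hi
    simp [pre]

lemma exists_twist {n M : ℕ} (K : Subgroup (Equiv.Perm (Fin n)))
    (f : (Fin M → Fin n) → Equiv.Perm (Fin n)) (hf : ∀ w, f w ∈ K)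
    (S : Finset (Fin M → Fin n)) :
    ∃ s ∈ VnG n K, ∀ x i, s x i = if M ≤ i ∧ pre M x ∈ S then f (pre M x) (x i) else x i := by
  induction S using Finset.induction_on with
  | empty => exact ⟨1, Subgroup.one_mem _, fun x i => by simp⟩
  | insert w S hw ih =>
    obtain ⟨s, hs, hsx⟩ := ih
    refine ⟨iterPermHomeo (List.ofFn w) (f w) * s, Subgroup.mul_mem _
      (Subgroup.subset_closure (Or.inr ⟨List.ofFn w, f w, hf w, rfl⟩)) hs, fun x i => ?_⟩
    have hp : pre M (s x) = pre M x := by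
      rw [pre_eq_iff]; intro j hj
      rw [hsx, if_neg (by omega)]
    rw [homeo_mul_apply]
    change iterPermFun _ _ (s x) i = _
    rw [iterPermFun, inCone_ofFn, hp]
    by_cases hxw : pre M x = w
    · subst hxw
      simp only [if_true, List.length_ofFn, hsx, hw, and_false, if_false, Finset.mem_insert_self,
        and_true]
      by_cases hi : i < M
      · simp [hi, not_le.mpr hi]
      · simp [hi, not_lt.mp hi]
    · simp [hxw, hsx]

lemma Loc.uniform {n : ℕ} {K : Subgroup (Equiv.Perm (Fin n))} {v : Cantor n → Cantor n}
    (hv : Loc K v) : ∃ M, ∀ x, ∃ l g, LocAt K v x M l g := by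
  choose m l g h using hv
  obtain ⟨T, hT⟩ := CompactSpace.elim_nhds_subcover (fun x : Cantor n => {y | Agr (m x) y x})
    (fun x => (agr_isOpen (m x) x).mem_nhds (fun _ _ => rfl))
  refine ⟨T.sup m, fun y => ?_⟩
  have hy : y ∈ ⋃ x ∈ T, {y : Cantor n | Agr (m x) y x} := by rw [hT]; trivial
  simp only [Set.mem_iUnion] at hy
  obtain ⟨x, hxT, hyx⟩ := hy
  have hle : m x ≤ T.sup m := Finset.le_sup hxT
  obtain ⟨k, hk⟩ := Nat.exists_eq_add_of_le hle
  have : LocAt K v y (m x) (l x) (g x) := by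
    refine ⟨(h x).1, fun x' hx' => ?_⟩
    have h1 := (h x).2 y hyx
    have h2 := (h x).2 x' (fun i hi => (hx' i hi).trans (hyx i hi))
    exact ⟨fun i hi => (h2.1 i hi).trans (h1.1 i hi).symm, h2.2⟩
  rw [hk]
  exact ⟨_, _, this.extend k⟩

lemma mem_of_loc {n : ℕ} (hn : 2 ≤ n) (K : Subgroup (Equiv.Perm (Fin n)))
    (v : Cantor n ≃ₜ Cantor n) (hv : Loc K v) : v ∈ VnG n K := by
  obtain ⟨M, hM⟩ := hv.uniform
  let z : Cantor n := fun _ => ⟨0, by omega⟩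
  let pt : (Fin M → Fin n) → Cantor n := fun w => appendWord (List.ofFn w) z
  have hpt : ∀ w, pre M (pt w) = w := fun w => (inCone_ofFn w _).mp (inCone_appendWord _ _)
  choose l f hlf using fun w => hM (pt w)
  obtain ⟨s, hs, hsx⟩ := exists_twist K f (fun w => (hlf w).1) Finset.univ
  simp only [Finset.mem_univ, and_true] at hsx
  have key : ∀ x, Agr (l (pre M x)) (v x) (v (pt (pre M x))) ∧
      ∀ i, v x (l (pre M x) + i) = f (pre M x) (x (M + i)) := fun x =>
    (hlf (pre M x)).2 x ((pre_eq_iff M _ _).mp (hpt _).symm)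
  have hp : ∀ x, pre M (s x) = pre M x := fun x => by
    rw [pre_eq_iff]; intro j hj
    rw [hsx, if_neg (by omega)]
  let e := Fintype.equivFin (Fin M → Fin n)
  let α : Fin (Fintype.card (Fin M → Fin n)) → List (Fin n) := fun i => List.ofFn (e.symm i)
  let b : (Fin M → Fin n) → List (Fin n) := fun w => List.ofFn (pre (l w) (v (pt w)))
  have hb : ∀ w y, inCone (b w) y ↔ Agr (l w) y (v (pt w)) := fun w y => by
    rw [inCone_ofFn, pre_eq_iff]
  have hbw : ∀ w x, inCone (b w) (v x) ↔ pre M x = w := by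
    intro w x
    rw [hb]
    constructor
    · intro h
      let u := glue M (pt w) (fun i => (f w)⁻¹ (v x (l w + i)))
      have hu : Agr M u (pt w) := glue_agr _ _ _
      obtain ⟨h1, h2⟩ := (hlf w).2 u hu
      have : v u = v x := by
        refine ext_split (l w) (fun i hi => (h1 i hi).trans (h i hi).symm) fun i => ?_
        rw [h2, show u (M + i) = (f w)⁻¹ (v x (l w + i)) from glue_add _ _ _ _]; simp
      have := v.injective this
      rw [← this]; exact ((pre_eq_iff M _ _).mpr hu).trans (hpt w)
    · rintro rfl; exact (key x).1
  have hpm : IsPrefixMap ⇑(v * s⁻¹) := by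
    refine ⟨_, α, fun i => b (e.symm i), fun x => ?_, fun y => ?_, fun i γ => ?_⟩
    · refine ⟨e (pre M x), ?_, fun j hj => ?_⟩
      · simp [α, inCone_ofFn]
      · have := (inCone_ofFn _ _).mp hj
        rw [this]; simp
    · obtain ⟨x, rfl⟩ := v.surjective y
      refine ⟨e (pre M x), ?_, fun j hj => ?_⟩
      · simp [hbw]
      · have := (hbw _ _).mp hj
        rw [this]; simp
    · set w := e.symm i with hw
      obtain ⟨x, hx⟩ := s.surjective (appendWord (α i) γ)
      have hpx : pre M x = w := by
        rw [← hp, hx]; exact (inCone_ofFn w _).mp (inCone_appendWord _ _)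
      rw [homeo_mul_apply, ← hx, homeo_inv_apply_self]
      rw [eq_appendWord _ _ ((hbw w x).mpr hpx)]
      congr 1
      funext j
      have h1 := (key x).2 j
      have h2 := hsx x (M + j)
      rw [hpx] at h1 h2
      rw [if_pos (by omega), hx] at h2
      have h3 := appendWord_add (α i) γ j
      have h4 : (α i).length = M := by simp [α]
      have h5 : (b w).length = l w := by simp [b]
      rw [h4] at h3
      rw [h5, h1, ← h2, h3]
  have : v = (v * s⁻¹) * s := by group
  rw [this]
  exact Subgroup.mul_mem _ (Subgroup.subset_closure (Or.inl hpm)) hs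

/-- The inverse of the transducer map. -/
def BFun {n : ℕ} (hmap : Fin n → Equiv.Perm (Fin n)) (y : Cantor n) : Cantor n
  | 0 => y 0
  | k + 1 => (hmap (BFun hmap y k))⁻¹ (y (k + 1))

lemma B_A {n : ℕ} (hmap : Fin n → Equiv.Perm (Fin n)) (x : Cantor n) :
    BFun hmap (AFun 1 hmap x) = x := by
  funext k
  induction k with
  | zero => rfl
  | succ k ih => simp [BFun, AFun, ih]

lemma A_B {n : ℕ} (hmap : Fin n → Equiv.Perm (Fin n)) (x : Cantor n) :
    AFun 1 hmap (BFun hmap x) = x := by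
  funext k
  cases k with
  | zero => rfl
  | succ k => simp [BFun, AFun]

lemma A_agr {n : ℕ} (hmap : Fin n → Equiv.Perm (Fin n)) {N : ℕ} {x y : Cantor n}
    (h : Agr N x y) : Agr N (AFun 1 hmap x) (AFun 1 hmap y) := by
  intro i hi
  cases i with
  | zero => simp [AFun, h 0 hi]
  | succ k => simp [AFun, h _ hi, h k (by omega)]

lemma B_agr {n : ℕ} (hmap : Fin n → Equiv.Perm (Fin n)) {N : ℕ} {x y : Cantor n}
    (h : Agr N x y) : Agr N (BFun hmap x) (BFun hmap y) := by
  intro i hi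
  induction i with
  | zero => simp [BFun, h 0 hi]
  | succ k ih => simp [BFun, h _ hi, ih (by omega)]

def AHomeo {n : ℕ} (hmap : Fin n → Equiv.Perm (Fin n)) : Cantor n ≃ₜ Cantor n where
  toFun := AFun 1 hmap
  invFun := BFun hmap
  left_inv := B_A hmap
  right_inv := A_B hmap
  continuous_toFun := continuous_of_agr _ fun i =>
    ⟨i + 1, fun _ _ h => A_agr hmap h i (by omega)⟩
  continuous_invFun := continuous_of_agr _ fun i =>
    ⟨i + 1, fun _ _ h => B_agr hmap h i (by omega)⟩

lemma hmap_unique {n : ℕ} {H : Subgroup (Equiv.Perm (Fin n))} (hH : Semiregular H)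
    {R : Set (Fin n)} (hR : IsTransversal H R) {h k : Equiv.Perm (Fin n)} (hh : h ∈ H)
    (hk : k ∈ H) (c : Fin n) (h1 : h c ∈ R) (h2 : k c ∈ R) : h = k := by
  have e : h c = k c := (hR c).unique ⟨h1, h, hh, rfl⟩ ⟨h2, k, hk, rfl⟩
  have := hH (k⁻¹ * h) (H.mul_mem (H.inv_mem hk) hh) ⟨c, by simp [e]⟩
  rw [inv_mul_eq_one] at this
  exact this.symm

lemma conj_mem {n : ℕ} {H : Subgroup (Equiv.Perm (Fin n))} {R : Set (Fin n)}
    {G : Subgroup (Equiv.Perm (Fin n))}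
    (hG : G ≤ Subgroup.normalizer (H : Set (Equiv.Perm (Fin n))) ⊓
      MulAction.stabilizer (Equiv.Perm (Fin n)) R)
    {g h : Equiv.Perm (Fin n)} (hg : g ∈ G) (hh : h ∈ H) : g * h * g⁻¹ ∈ H :=
  (Subgroup.mem_normalizer_iff.mp (hG hg).1 h).mp hh

lemma hmap_key {n : ℕ} {H : Subgroup (Equiv.Perm (Fin n))} {R : Set (Fin n)}
    {G : Subgroup (Equiv.Perm (Fin n))} {hmap : Fin n → Equiv.Perm (Fin n)}
    (hH : Semiregular H)
    (hR : IsTransversal H R)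
    (hG : G ≤ Subgroup.normalizer (H : Set (Equiv.Perm (Fin n))) ⊓
      MulAction.stabilizer (Equiv.Perm (Fin n)) R)
    (hhmap : IsHmap H R hmap)
    {g h : Equiv.Perm (Fin n)} (hg : g ∈ G) (hh : h ∈ H) (c d : Fin n) :
    hmap (h (g c)) (h (g d)) = g (hmap c d) := by
  have e : hmap (h (g c)) * h = g * hmap c * g⁻¹ := by
    refine hmap_unique hH hR (H.mul_mem (hhmap _).1 hh) (conj_mem hG hg (hhmap c).1) (g c) ?_ ?_
    · exact (hhmap _).2
    · have h1 : g • R = R := (hG hg).2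
      have : g • (hmap c c) ∈ g • R := Set.smul_mem_smul_set (hhmap c).2
      rw [h1] at this
      simpa using this
  have := congrArg (fun p : Equiv.Perm (Fin n) => p (g d)) e
  simpa using this

lemma mem_sup_decomp {n : ℕ} {H : Subgroup (Equiv.Perm (Fin n))} {R : Set (Fin n)}
    {G : Subgroup (Equiv.Perm (Fin n))}
    (hG : G ≤ Subgroup.normalizer (H : Set (Equiv.Perm (Fin n))) ⊓
      MulAction.stabilizer (Equiv.Perm (Fin n)) R)
    {k : Equiv.Perm (Fin n)} (hk : k ∈ H ⊔ G) :
    ∃ h ∈ H, ∃ g ∈ G, k = h * g := by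
  rw [Subgroup.sup_eq_closure] at hk
  induction hk using Subgroup.closure_induction with
  | mem x hx =>
    rcases hx with hx | hx
    · exact ⟨x, hx, 1, G.one_mem, by simp⟩
    · exact ⟨1, H.one_mem, x, hx, by simp⟩
  | one => exact ⟨1, H.one_mem, 1, G.one_mem, by simp⟩
  | mul x y _ _ hx hy =>
    obtain ⟨h, hh, g, hg, rfl⟩ := hx
    obtain ⟨h', hh', g', hg', rfl⟩ := hy
    exact ⟨h * (g * h' * g⁻¹), H.mul_mem hh (conj_mem hG hg hh'), g * g', G.mul_mem hg hg',
      by group⟩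
  | inv x _ hx =>
    obtain ⟨h, hh, g, hg, rfl⟩ := hx
    exact ⟨g⁻¹ * h⁻¹ * g⁻¹⁻¹, conj_mem hG (G.inv_mem hg) (H.inv_mem hh), g⁻¹, G.inv_mem hg,
      by group⟩

lemma loc_forward {n : ℕ} {H : Subgroup (Equiv.Perm (Fin n))} {R : Set (Fin n)}
    {G : Subgroup (Equiv.Perm (Fin n))} {hmap : Fin n → Equiv.Perm (Fin n)}
    (hH : Semiregular H)
    (hR : IsTransversal H R)
    (hG : G ≤ Subgroup.normalizer (H : Set (Equiv.Perm (Fin n))) ⊓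
      MulAction.stabilizer (Equiv.Perm (Fin n)) R)
    (hhmap : IsHmap H R hmap)
    (v : Cantor n → Cantor n) (hv : Loc (H ⊔ G) v) :
    Loc G (fun y => AFun 1 hmap (v (BFun hmap y))) := by
  intro y
  obtain ⟨m, l, k, hk⟩ := hv (BFun hmap y)
  obtain ⟨h, hh, g, hg, rfl⟩ := mem_sup_decomp hG hk.1
  refine ⟨m + 1, l + 1, g, hg, fun y' hy' => ?_⟩
  have hx := B_agr hmap hy'
  refine ⟨A_agr hmap ((hk.extend 1).2 _ hx).1, fun i => ?_⟩
  have h2 := (hk.2 _ (fun j hj => hx j (by omega))).2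
  have e1 : l + 1 + i = (l + i) + 1 := by omega
  have e2 : m + 1 + i = (m + i) + 1 := by omega
  have e3 : y' (m + 1 + i) = AFun 1 hmap (BFun hmap y') (m + 1 + i) := by rw [A_B]
  rw [e3, e1, e2]
  simp only [AFun]
  rw [add_assoc l i 1, h2, h2]
  exact hmap_key hH hR hG hhmap hg hh _ _

lemma loc_backward {n : ℕ} {H : Subgroup (Equiv.Perm (Fin n))} {R : Set (Fin n)}
    {G : Subgroup (Equiv.Perm (Fin n))} {hmap : Fin n → Equiv.Perm (Fin n)}
    (hH : Semiregular H)
    (hR : IsTransversal H R)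
    (hG : G ≤ Subgroup.normalizer (H : Set (Equiv.Perm (Fin n))) ⊓
      MulAction.stabilizer (Equiv.Perm (Fin n)) R)
    (hhmap : IsHmap H R hmap)
    (w : Cantor n → Cantor n) (hw : Loc G w) :
    Loc (H ⊔ G) (fun x => BFun hmap (w (AFun 1 hmap x))) := by
  intro x
  obtain ⟨m, l, g, hg⟩ := hw (AFun 1 hmap x)
  set b := BFun hmap (w (AFun 1 hmap x)) l with hb
  set a := x m with ha
  set h := (hmap b)⁻¹ * (g * hmap a * g⁻¹) with hhdef
  have hh : h ∈ H := H.mul_mem (H.inv_mem (hhmap b).1) (conj_mem hG hg.1 (hhmap a).1)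
  refine ⟨m + 1, l + 1, h * g, Subgroup.mul_mem _ (Subgroup.mem_sup_left hh)
    (Subgroup.mem_sup_right hg.1), fun x' hx' => ?_⟩
  have hy := A_agr hmap hx'
  have hz := B_agr hmap ((hg.extend 1).2 _ hy).1
  refine ⟨hz, fun i => ?_⟩
  have h2 := (hg.2 _ (fun j hj => hy j (by omega))).2
  have step : ∀ i, BFun hmap (w (AFun 1 hmap x')) (l + 1 + i) =
      (hmap (BFun hmap (w (AFun 1 hmap x')) (l + i)))⁻¹
        (g (hmap (x' (m + i)) (x' (m + 1 + i)))) := by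
    intro i
    have e1 : l + 1 + i = (l + i) + 1 := by omega
    have e2 : m + 1 + i = (m + i) + 1 := by omega
    rw [e1, e2]
    simp only [BFun]
    rw [add_assoc l i 1, h2, ← add_assoc]
    rfl
  change BFun hmap (w (AFun 1 hmap x')) (l + 1 + i) = (h * g) (x' (m + 1 + i))
  induction i with
  | zero =>
    rw [step 0]
    have hz0 := hz l (by omega)
    have hx0 := hx' m (by omega)
    simp only [add_zero]
    rw [hz0, hx0]
    simp [hhdef, ← hb, ← ha]
  | succ i ih =>
    rw [step (i + 1)]
    have e1 : l + (i + 1) = l + 1 + i := by omega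
    have e2 : m + (i + 1) = m + 1 + i := by omega
    rw [e1, e2, ih, Equiv.Perm.inv_eq_iff_eq]
    exact (hmap_key hH hR hG hhmap hg.1 hh _ _).symm

end TransducerProof

/-- Let `H ≤ S_n` be semiregular with orbit transversal `R`, and
`G ≤ N_{S_n}(H) ⊓ Stab_{S_n}(R)`.  Then the transducer map `A_id` is a
homeomorphism `A` of the Cantor space, and conjugation `v ↦ A_id⁻¹ ∘ v ∘ A_id`
(first `A_id⁻¹`, then `v`, then `A_id`, i.e. `A * v * A⁻¹` in our convention)
is a group isomorphism of `V_n(HG)` onto `V_n(G)`. -/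
theorem conjugation_by_transducer_is_iso (n : ℕ) (hn : 2 ≤ n)
    (H : Subgroup (Equiv.Perm (Fin n))) (hH : Semiregular H)
    (R : Set (Fin n)) (hR : IsTransversal H R)
    (G : Subgroup (Equiv.Perm (Fin n)))
    (hG : G ≤ Subgroup.normalizer (H : Set (Equiv.Perm (Fin n))) ⊓ MulAction.stabilizer (Equiv.Perm (Fin n)) R)
    (hmap : Fin n → Equiv.Perm (Fin n)) (hhmap : IsHmap H R hmap) :
    IsHomeomorph (AFun 1 hmap) ∧
      ∃ A : Cantor n ≃ₜ Cantor n, ⇑A = AFun 1 hmap ∧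
        ∀ v : Cantor n ≃ₜ Cantor n, v ∈ VnG n (H ⊔ G) ↔ A * v * A⁻¹ ∈ VnG n G := by
  refine ⟨(TransducerProof.AHomeo hmap).isHomeomorph, TransducerProof.AHomeo hmap, rfl,
    fun v => ⟨fun hv => ?_, fun hv => ?_⟩⟩
  · exact TransducerProof.mem_of_loc hn G _ (TransducerProof.loc_forward hH hR hG hhmap v
      (TransducerProof.loc_of_mem _ v hv))
  · refine TransducerProof.mem_of_loc hn _ v ?_
    have h := TransducerProof.loc_backward hH hR hG hhmap _ (TransducerProof.loc_of_mem _ _ hv)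
    have e : (fun x => TransducerProof.BFun hmap
        ((TransducerProof.AHomeo hmap * v * (TransducerProof.AHomeo hmap)⁻¹)
          (AFun 1 hmap x))) = ⇑v := by
      funext x
      change TransducerProof.BFun hmap (AFun 1 hmap (v (TransducerProof.BFun hmap
        (AFun 1 hmap x)))) = v x
      rw [TransducerProof.B_A, TransducerProof.B_A]
    rw [e] at h
    exact h
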